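/- arXiv:2409.12461 — 2 statements merged into one kernel-verified Lean document; each statement's English description precedes it below -/
import Mathlib

section
/- Let G be a game arena, α=(O_p)_{p∈P} an objective profile, and S∈{Pos,Σ}. Every Nash equilibrium s∈S for α and S belongs to T_{G,α,S}. Consequently, for any set O of plays, if out(t)∈O for every t∈T_{G,α,S}, then out(s)∈O for every Nash equilibrium s∈S for α and S. -/
open scoped Classical

namespace EpistemicRV

/-- Boolean formulas over variables of type `α`. -/
inductive BForm (α : Type) : Type where
  | tru : BForm α
  | fls : BForm α
  | var : α → BForm α
  | not : BForm α → BForm α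
  | and : BForm α → BForm α → BForm α
  | or : BForm α → BForm α → BForm α

/-- Evaluation of a Boolean formula under a truth assignment. -/
def BForm.eval {α : Type} (θ : α → Prop) : BForm α → Prop
  | .tru => True
  | .fls => False
  | .var a => θ a
  | .not f => ¬ (f.eval θ)
  | .and f g => f.eval θ ∧ g.eval θ
  | .or f g => f.eval θ ∨ g.eval θ

/-- Renaming of variables of a Boolean formula. -/
def BForm.map {α β : Type} (h : α → β) : BForm α → BForm β
  | .tru => .tru
  | .fls => .fls
  | .var a => .var (h a)
  | .not f => .not (f.map h)
  | .and f g => .and (f.map h) (g.map h)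
  | .or f g => .or (f.map h) (g.map h)

/-- A game arena: each vertex has an owner, there is an initial vertex and an
edge relation.  (Totality of the edge relation is stated as a separate
hypothesis where needed.) -/
structure Arena (P V : Type) : Type where
  owner : V → P
  v0 : V
  edge : V → V → Prop

/-- A strategy: given the (reversed) past history and the current vertex,
it yields the next vertex.  A history `h v` (ending in the current vertex `v`)
is represented by the pair of the reversed list `h` and `v`. -/
abbrev Strat (V : Type) : Type := List V → V → V

/-- A strategy profile assigns a strategy to every player. -/
abbrev Profile (P V : Type) : Type := P → Strat V

variable {P V : Type}

/-- A strategy respecting the edge relation. -/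
def ValidStrat (A : Arena P V) (s : Strat V) : Prop := ∀ h v, A.edge v (s h v)

/-- A positional strategy only depends on the current vertex. -/
def PositionalStrat (s : Strat V) : Prop := ∀ h h' v, s h v = s h' v

/-- The class Σ of all strategies. -/
def allClass (A : Arena P V) : Set (Strat V) := {s | ValidStrat A s}

/-- The class Pos of positional strategies. -/
def posClass (A : Arena P V) : Set (Strat V) := {s | ValidStrat A s ∧ PositionalStrat s}

/-- Strategy profiles ranging over the class `C` of strategies. -/
def profiles (A : Arena P V) (C : Set (Strat V)) : Set (Profile P V) :=
  {s | ∀ p, s p ∈ C}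

/-- `upd s p t` is the profile `s[p ↦ t]`. -/
noncomputable def upd (s : Profile P V) (p : P) (t : Strat V) : Profile P V :=
  fun q => if q = p then t else s q

/-- The reversed history of length `n+1` generated by the profile `s`. -/
def histOf (A : Arena P V) (s : Profile P V) : ℕ → List V
  | 0 => [A.v0]
  | n + 1 =>
    match histOf A s n with
    | [] => [A.v0]
    | v :: h => s (A.owner v) h v :: v :: h

/-- The outcome play `out(s)` of the profile `s`. -/
def Out (A : Arena P V) (s : Profile P V) : ℕ → V :=
  fun n => (histOf A s n).getD 0 A.v0

/-- The set of plays of an arena. -/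
def plays (A : Arena P V) : Set (ℕ → V) :=
  {ρ | ρ 0 = A.v0 ∧ ∀ i, A.edge (ρ i) (ρ (i + 1))}

/-- `Inf(ρ)`: the set of vertices occurring infinitely often in `ρ`. -/
def InfSet (ρ : ℕ → V) : Set V := {v | ∀ i, ∃ j, i ≤ j ∧ ρ j = v}

/-- The Büchi objective for the set `U` of vertices. -/
def Buchi (U : Set V) : Set (ℕ → V) := {ρ | (InfSet ρ ∩ U).Nonempty}

/-- The Muller objective for a Boolean formula over the vertices. -/
def Muller (φ : BForm V) : Set (ℕ → V) := {ρ | φ.eval (fun v => v ∈ InfSet ρ)}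

/-- `s` is a Nash equilibrium for the objective profile `O` and the class `C`. -/
def NashEq (A : Arena P V) (O : P → Set (ℕ → V)) (C : Set (Strat V))
    (s : Profile P V) : Prop :=
  ∀ p, ∀ t ∈ C, Out A (upd s p t) ∈ O p → Out A s ∈ O p

/-- `t` is a winning strategy of player `p` for objective `Op` over class `C`. -/
def WinningStrat (A : Arena P V) (Op : Set (ℕ → V)) (C : Set (Strat V))
    (p : P) (t : Strat V) : Prop :=
  t ∈ C ∧ ∀ s ∈ profiles A C, Out A (upd s p t) ∈ Op

/-- Knowledge operator of a single accessibility relation. -/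
def Kop {W : Type} (R : W → W → Prop) (E : Set W) : Set W :=
  {w | ∀ w', R w w' → w' ∈ E}

/-- Mutual knowledge operator. -/
def MKop {W : Type} (R : P → W → W → Prop) (E : Set W) : Set W :=
  ⋂ p, Kop (R p) E

/-- Common knowledge operator: `CK(E) = ⋂_{i ≥ 1} MK^i(E)`. -/
def CKop {W : Type} (R : P → W → W → Prop) (E : Set W) : Set W :=
  ⋂ i ∈ Set.Ici (1 : ℕ), (MKop R)^[i] E

/-- Player `p` is rational in world `w` (for arena `A`, objective profile `O`,
class `C`, accessibility relations `R` and strategy assignment `σ`). -/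
def RationalIn (A : Arena P V) (O : P → Set (ℕ → V)) (C : Set (Strat V))
    {W : Type} (R : P → W → W → Prop) (σ : W → Profile P V) (p : P) (w : W) : Prop :=
  ¬ ∃ t ∈ C,
      (∀ w', R p w w' → (Out A (σ w') ∈ O p → Out A (upd (σ w') p t) ∈ O p)) ∧
      (∃ w', R p w w' ∧ Out A (σ w') ∉ O p ∧ Out A (upd (σ w') p t) ∈ O p)

/-- The set of worlds in which every player is rational. -/
def RAT (A : Arena P V) (O : P → Set (ℕ → V)) (C : Set (Strat V))
    {W : Type} (R : P → W → W → Prop) (σ : W → Profile P V) : Set W :=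
  {w | ∀ p, RationalIn A O C R σ p w}

/-- An epistemic model for the arena `A` and the class `C` of strategies. -/
structure EModel {P V : Type} (A : Arena P V) (C : Set (Strat V)) : Type 1 where
  W : Type
  finW : Finite W
  R : P → W → W → Prop
  equivR : ∀ p, Equivalence (R p)
  σ : W → Profile P V
  memC : ∀ w, σ w ∈ profiles A C
  consistent : ∀ p w w', R p w w' → σ w p = σ w' p

/-- The characterization `T_{G,α,S}` of common knowledge of rationality. -/
def Tchar (A : Arena P V) (O : P → Set (ℕ → V)) (C : Set (Strat V)) :
    Set (Profile P V) :=
  {s | ∃ M : EModel A C, ∃ w : M.W,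
        w ∈ CKop M.R (RAT A O C M.R M.σ) ∧ M.σ w = s}

end EpistemicRV

namespace EpistemicRV

/-- The set of all worlds is commonly known everywhere. -/
theorem CKop_univ {P W : Type} (R : P → W → W → Prop) :
    CKop R (Set.univ : Set W) = Set.univ := by
  have hMK : MKop R (Set.univ : Set W) = Set.univ := by
    simp [MKop, Kop]
  simp [CKop, Function.iterate_fixed hMK]

/-- The model with a single world, to which the profile `s` is assigned. -/
def EModel.single {P V : Type} (A : Arena P V) (C : Set (Strat V))
    (s : Profile P V) (hs : s ∈ profiles A C) : EModel A C where
  W := Unit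
  finW := inferInstance
  R := fun _ _ _ => True
  equivR := fun _ => ⟨fun _ => trivial, fun _ => trivial, fun _ _ => trivial⟩
  σ := fun _ => s
  memC := fun _ => hs
  consistent := fun _ _ _ _ => rfl

/-- In the single-world model of a Nash equilibrium every player is rational. -/
theorem NashEq.RAT_single {P V : Type} {A : Arena P V} {O : P → Set (ℕ → V)}
    {C : Set (Strat V)} {s : Profile P V} (hs : s ∈ profiles A C)
    (hnash : NashEq A O C s) :
    RAT A O C (EModel.single A C s hs).R (EModel.single A C s hs).σ = Set.univ := by
  refine Set.eq_univ_of_forall fun w p => ?_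
  rintro ⟨t, ht, -, w', -, hlose, hwin⟩
  exact hlose (hnash p t ht hwin)

/-- Every Nash equilibrium is compatible with common knowledge of rationality. -/
theorem NashEq.mem_Tchar {P V : Type} {A : Arena P V} {O : P → Set (ℕ → V)}
    {C : Set (Strat V)} {s : Profile P V} (hs : s ∈ profiles A C)
    (hnash : NashEq A O C s) : s ∈ Tchar A O C := by
  refine ⟨EModel.single A C s hs, (), ?_, rfl⟩
  rw [hnash.RAT_single hs, CKop_univ]
  exact Set.mem_univ _

/-- every Nash equilibrium over `S ∈ {Pos, Σ}` belongs to
`T_{G,α,S}`; consequently if every profile in `T_{G,α,S}` satisfies a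
specification `O`, then so does every Nash equilibrium. -/
theorem nash_mem_Tchar {P V : Type} [Fintype P] [Fintype V]
    (A : Arena P V) (htotal : ∀ v, ∃ u, A.edge v u)
    (O : P → Set (ℕ → V)) (C : Set (Strat V))
    (hC : C = posClass A ∨ C = allClass A)
    (s : Profile P V) (hs : s ∈ profiles A C) (hnash : NashEq A O C s) :
    s ∈ Tchar A O C ∧
      ∀ Ospec : Set (ℕ → V),
        (∀ t ∈ Tchar A O C, Out A t ∈ Ospec) → Out A s ∈ Ospec := by
  exact ⟨hnash.mem_Tchar hs, fun _ h => h s (hnash.mem_Tchar hs)⟩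

end EpistemicRV
end

section
/- Let ψ be a Boolean formula over variables x_1,…,x_n,y_1,…,y_m, let G_ψ be the two-player cycle arena constructed from ψ with players A and E, and let α=(O_A,O_E) where O_A is the set of all plays and O_E=Muller(ψ). Then the quantified formula ∀x_1…x_n ∃y_1…y_m ψ is true if and only if every Nash equilibrium s over positional strategies (for α and Pos) satisfies out(s)∈Muller(ψ). -/
open scoped Classical

namespace EpistemicRV

/-- Vertices of the two-player cycle arena `G_ψ`: choice vertices `a i` and
literal vertices `x i b` of player `A`, and choice vertices `e j` and literal
vertices `y j b` of player `E` (`b = true` is the positive literal). -/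
inductive CycleV (n m : ℕ) : Type where
  | a : Fin n → CycleV n m
  | x : Fin n → Bool → CycleV n m
  | e : Fin m → CycleV n m
  | y : Fin m → Bool → CycleV n m

/-- Edges of the cycle arena:
`a_i → x_i, x̄_i`, `x_i, x̄_i → a_{i+1}` (or `→ e_1` when `i = n`),
`e_j → y_j, ȳ_j`, `y_j, ȳ_j → e_{j+1}` (or `→ a_1` when `j = m`). -/
def cycleEdge {n m : ℕ} : CycleV n m → CycleV n m → Prop
  | .a i, .x i' _ => i = i'
  | .x i _, .a i' => (i : ℕ) + 1 = (i' : ℕ)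
  | .x i _, .e j => (i : ℕ) + 1 = n ∧ (j : ℕ) = 0
  | .e j, .y j' _ => j = j'
  | .y j _, .e j' => (j : ℕ) + 1 = (j' : ℕ)
  | .y j _, .a i' => (j : ℕ) + 1 = m ∧ (i' : ℕ) = 0
  | _, _ => False

/-- The two-player cycle arena: the player `false` is `A` and owns the `a`/`x`
vertices, the player `true` is `E` and owns the `e`/`y` vertices; the initial
vertex is `a_1`. -/
def cycleArena (n m : ℕ) (hn : 0 < n) : Arena Bool (CycleV n m) where
  owner := fun v =>
    match v with
    | .a _ => false
    | .x _ _ => false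
    | .e _ => true
    | .y _ _ => true
  v0 := .a ⟨0, hn⟩
  edge := cycleEdge

/-- The positive literal vertex corresponding to a variable
(`x_i` on the left, `y_j` on the right). -/
def litVertex {n m : ℕ} : Fin n ⊕ Fin m → CycleV n m :=
  Sum.elim (fun i => .x i true) (fun j => .y j true)

/-- The truth assignment `θ_s` corresponding to a positional profile `s`:
a variable is true iff its positive literal vertex is chosen. -/
def thetaOf {n m : ℕ} (s : Profile Bool (CycleV n m)) : Fin n ⊕ Fin m → Prop
  | .inl i => s false [] (.a i) = CycleV.x i true
  | .inr j => s true [] (.e j) = CycleV.y j true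

end EpistemicRV

namespace EpistemicRV

theorem BForm.eval_map {α β : Type} (h : α → β) (θ : β → Prop) (φ : BForm α) :
    (φ.map h).eval θ ↔ φ.eval (θ ∘ h) := by
  induction φ <;> simp_all [BForm.map, BForm.eval]

theorem histOf_ne_nil (A : Arena P V) (s : Profile P V) (k : ℕ) : histOf A s k ≠ [] := by
  cases k with
  | zero => simp [histOf]
  | succ k => rw [histOf]; split <;> simp

theorem out_zero (A : Arena P V) (s : Profile P V) : Out A s 0 = A.v0 := rfl

theorem exists_out_succ (A : Arena P V) (s : Profile P V) (k : ℕ) :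
    ∃ h, Out A s (k + 1) = s (A.owner (Out A s k)) h (Out A s k) := by
  unfold Out
  rw [histOf]
  rcases hh : histOf A s k with _ | ⟨v, h⟩
  · exact absurd hh (histOf_ne_nil A s k)
  · exact ⟨h, by simp⟩

theorem out_succ_of_positional {A : Arena P V} {s : Profile P V}
    (hs : ∀ p, PositionalStrat (s p)) (k : ℕ) :
    Out A s (k + 1) = s (A.owner (Out A s k)) [] (Out A s k) := by
  obtain ⟨h, hh⟩ := exists_out_succ A s k
  rw [hh, hs _ h []]

theorem out_mem_plays {A : Arena P V} {s : Profile P V} (hs : ∀ p, ValidStrat A (s p)) :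
    Out A s ∈ plays A := by
  refine ⟨out_zero A s, fun k => ?_⟩
  obtain ⟨h, hh⟩ := exists_out_succ A s k
  rw [hh]
  exact hs _ h _

theorem upd_mem_profiles {A : Arena P V} {C : Set (Strat V)} {s : Profile P V}
    (hs : s ∈ profiles A C) (p : P) {t : Strat V} (ht : t ∈ C) : upd s p t ∈ profiles A C := by
  intro q
  unfold upd
  split
  · exact ht
  · exact hs q

/-- The position of a vertex along the cycle, starting from `a_1`. -/
def cyclePos {n m : ℕ} : CycleV n m → ℕ
  | .a i => 2 * i
  | .x i _ => 2 * i + 1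
  | .e j => 2 * n + 2 * j
  | .y j _ => 2 * n + 2 * j + 1

theorem cyclePos_of_edge {n m : ℕ} {u v : CycleV n m} (h : cycleEdge u v) :
    cyclePos v = (cyclePos u + 1) % (2 * (n + m)) := by
  rcases u with i | ⟨i, b⟩ | j | ⟨j, b⟩ <;> rcases v with i' | ⟨i', b'⟩ | j' | ⟨j', b'⟩ <;>
    simp only [cycleEdge, cyclePos] at h ⊢ <;> try subst h
  case y.a => rw [h.2, show 2 * n + 2 * (j : ℕ) + 1 + 1 = 2 * (n + m) by omega]; simp
  all_goals rw [Nat.mod_eq_of_lt] <;> omega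

theorem cyclePos_of_mem_plays {n m : ℕ} {hn : 0 < n} {ρ : ℕ → CycleV n m}
    (hρ : ρ ∈ plays (cycleArena n m hn)) (k : ℕ) : cyclePos (ρ k) = k % (2 * (n + m)) := by
  induction k with
  | zero => rw [hρ.1]; simp [cycleArena, cyclePos]
  | succ k ih => rw [cyclePos_of_edge (hρ.2 k), ih, Nat.mod_add_mod]

/-- The vertex at which the value of a variable is chosen. -/
def choiceVertex {n m : ℕ} : Fin n ⊕ Fin m → CycleV n m :=
  Sum.elim .a .e

theorem eq_choiceVertex_of_cyclePos_eq {n m : ℕ} {u : CycleV n m} {v : Fin n ⊕ Fin m}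
    (h : cyclePos u = cyclePos (choiceVertex v : CycleV n m)) : u = choiceVertex v := by
  rcases u with i | ⟨i, b⟩ | j | ⟨j, b⟩ <;> rcases v with i' | j' <;>
    simp only [choiceVertex, cyclePos, Sum.elim_inl, Sum.elim_inr, reduceCtorEq,
      CycleV.a.injEq, CycleV.e.injEq, Fin.ext_iff] at h ⊢ <;> omega

theorem cyclePos_choiceVertex_lt {n m : ℕ} (v : Fin n ⊕ Fin m) :
    cyclePos (choiceVertex v : CycleV n m) < 2 * (n + m) := by
  rcases v with i | j <;> simp only [choiceVertex, cyclePos, Sum.elim_inl, Sum.elim_inr] <;> omega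

theorem eq_choiceVertex_of_edge {n m : ℕ} {u : CycleV n m} {v : Fin n ⊕ Fin m}
    (h : cycleEdge u (litVertex v)) : u = choiceVertex v := by
  rcases u with i | ⟨i, b⟩ | j | ⟨j, b⟩ <;> rcases v with i' | j' <;>
    simp_all [choiceVertex, litVertex, cycleEdge]

theorem litVertex_ne_v0 {n m : ℕ} (hn : 0 < n) (v : Fin n ⊕ Fin m) :
    (cycleArena n m hn).v0 ≠ litVertex v := by
  rcases v with i | j <;> simp [cycleArena, litVertex]

theorem thetaOf_iff {n m : ℕ} (hn : 0 < n) (s : Profile Bool (CycleV n m)) (v : Fin n ⊕ Fin m) :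
    thetaOf s v ↔
      s ((cycleArena n m hn).owner (choiceVertex v)) [] (choiceVertex v) = litVertex v := by
  rcases v with i | j <;> rfl

theorem litVertex_mem_infSet_iff {n m : ℕ} {hn : 0 < n} {s : Profile Bool (CycleV n m)}
    (hs : s ∈ profiles (cycleArena n m hn) (posClass (cycleArena n m hn)))
    (v : Fin n ⊕ Fin m) :
    litVertex v ∈ InfSet (Out (cycleArena n m hn) s) ↔ thetaOf s v := by
  have hplay := out_mem_plays fun p => (hs p).1
  have hsucc := out_succ_of_positional (A := cycleArena n m hn) fun p => (hs p).2
  rw [thetaOf_iff hn]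
  constructor
  · intro h
    obtain ⟨k, -, hk⟩ := h 0
    cases k with
    | zero => exact absurd hk (litVertex_ne_v0 hn v)
    | succ k =>
      have hedge := hplay.2 k
      rw [hk] at hedge
      rw [← eq_choiceVertex_of_edge hedge, ← hsucc k, hk]
  · intro h i
    have hv := cyclePos_choiceVertex_lt v
    set k := 2 * (n + m) * i + cyclePos (choiceVertex v : CycleV n m) with hk
    have hik : i ≤ 2 * (n + m) * i := Nat.le_mul_of_pos_left i (by omega)
    have hout : Out (cycleArena n m hn) s k = choiceVertex v := by
      apply eq_choiceVertex_of_cyclePos_eq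
      rw [cyclePos_of_mem_plays hplay, hk, Nat.mul_add_mod, Nat.mod_eq_of_lt hv]
    exact ⟨k + 1, by omega, by rw [hsucc, hout, h]⟩

theorem out_mem_muller_iff {n m : ℕ} {hn : 0 < n} {s : Profile Bool (CycleV n m)}
    (hs : s ∈ profiles (cycleArena n m hn) (posClass (cycleArena n m hn)))
    (ψ : BForm (Fin n ⊕ Fin m)) :
    Out (cycleArena n m hn) s ∈ Muller (ψ.map litVertex) ↔ ψ.eval (thetaOf s) := by
  have hθ : (fun v => v ∈ InfSet (Out (cycleArena n m hn) s)) ∘ litVertex = thetaOf s :=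
    funext fun v => propext (litVertex_mem_infSet_iff hs v)
  rw [← hθ, ← BForm.eval_map]
  rfl

/-- The positional strategy choosing literals according to the assignments `f` and `g`. -/
noncomputable def assignStrat {n m : ℕ} (hn : 0 < n) (hm : 0 < m) (f : Fin n → Prop)
    (g : Fin m → Prop) : Strat (CycleV n m)
  | _, .a i => .x i (decide (f i))
  | _, .x i _ => if h : (i : ℕ) + 1 < n then .a ⟨i + 1, h⟩ else .e ⟨0, hm⟩
  | _, .e j => .y j (decide (g j))
  | _, .y j _ => if h : (j : ℕ) + 1 < m then .e ⟨j + 1, h⟩ else .a ⟨0, hn⟩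

theorem assignStrat_mem_posClass {n m : ℕ} (hn : 0 < n) (hm : 0 < m) (f : Fin n → Prop)
    (g : Fin m → Prop) : assignStrat hn hm f g ∈ posClass (cycleArena n m hn) := by
  refine ⟨fun h v => ?_, fun h h' v => ?_⟩
  · rcases v with i | ⟨i, b⟩ | j | ⟨j, b⟩ <;> simp only [assignStrat, cycleArena]
    · simp [cycleEdge]
    · split <;> simp only [cycleEdge, and_true]; omega
    · simp [cycleEdge]
    · split <;> simp only [cycleEdge, and_true]; omega
  · cases v <;> rfl

theorem thetaOf_comp_inl {n m : ℕ} {hn : 0 < n} {hm : 0 < m} {f : Fin n → Prop}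
    {g : Fin m → Prop} {s : Profile Bool (CycleV n m)} (hs : s false = assignStrat hn hm f g) :
    thetaOf s ∘ Sum.inl = f := by
  funext i
  simp [thetaOf, hs, assignStrat]

theorem thetaOf_comp_inr {n m : ℕ} {hn : 0 < n} {hm : 0 < m} {f : Fin n → Prop}
    {g : Fin m → Prop} {s : Profile Bool (CycleV n m)} (hs : s true = assignStrat hn hm f g) :
    thetaOf s ∘ Sum.inr = g := by
  funext j
  simp [thetaOf, hs, assignStrat]

/-- with `O_A` the set of all plays and `O_E = Muller(ψ)`,
`∀x ∃y ψ` is true iff every Nash equilibrium over positional strategies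
satisfies `out(s) ∈ Muller(ψ)`. -/
theorem forall_exists_iff_nash (n m : ℕ) (hn : 0 < n) (hm : 0 < m)
    (ψ : BForm (Fin n ⊕ Fin m)) :
    (∀ f : Fin n → Prop, ∃ g : Fin m → Prop, ψ.eval (Sum.elim f g)) ↔
      (∀ s ∈ profiles (cycleArena n m hn) (posClass (cycleArena n m hn)),
        NashEq (cycleArena n m hn)
          (fun p =>
            cond p (Muller (ψ.map litVertex)) (plays (cycleArena n m hn)))
          (posClass (cycleArena n m hn)) s →
        Out (cycleArena n m hn) s ∈ Muller (ψ.map litVertex)) := by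
  constructor
  · intro h s hs hNash
    obtain ⟨g, hg⟩ := h (thetaOf s ∘ Sum.inl)
    have ht := assignStrat_mem_posClass hn hm (thetaOf s ∘ Sum.inl) g
    refine hNash true _ ht ((out_mem_muller_iff (upd_mem_profiles hs true ht) ψ).2 ?_)
    have hinl (t : Strat (CycleV n m)) :
        thetaOf (upd s true t) ∘ Sum.inl = thetaOf s ∘ Sum.inl := by
      funext i
      simp [thetaOf, upd]
    rw [← Sum.elim_comp_inl_inr (thetaOf (upd s true _)), thetaOf_comp_inr (if_pos rfl), hinl]
    exact hg
  · intro h f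
    by_contra! hf
    have hlose : ∀ s ∈ profiles (cycleArena n m hn) (posClass (cycleArena n m hn)),
        s false = assignStrat hn hm f (fun _ => True) →
        Out (cycleArena n m hn) s ∉ Muller (ψ.map litVertex) := by
      intro s hs hsf
      rw [out_mem_muller_iff hs, ← Sum.elim_comp_inl_inr (thetaOf s), thetaOf_comp_inl hsf]
      exact hf _
    have ht := assignStrat_mem_posClass hn hm f (fun _ => True)
    have hs : (fun _ => assignStrat hn hm f (fun _ => True)) ∈
        profiles (cycleArena n m hn) (posClass (cycleArena n m hn)) := fun _ => ht
    refine hlose _ hs rfl (h _ hs fun p t htC hwin => ?_)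
    cases p with
    | false => exact out_mem_plays fun p => (hs p).1
    | true => exact absurd hwin (hlose _ (upd_mem_profiles hs true htC) (if_neg Bool.false_ne_true))

end EpistemicRV
end
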